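/- Every invariant subspace N of ℂ[x,x⁻¹] with N ≠ ℂ[x,x⁻¹] is finitely generated as a module over the polynomial subring ℂ[x]; equivalently, there is an integer K such that N ⊆ x^{−K}ℂ[x]. -/

import Mathlib

noncomputable section

/-- The Laurent polynomial ring `ℂ[x,x⁻¹]`, viewed as the space of finitely supported
coefficient functions `ℤ →₀ ℂ`; the monomial `x^n` is `Finsupp.single n 1`. -/
abbrev LaurentC : Type := ℤ →₀ ℂ

/-- The `ℂ`-linear endomorphism of `ℂ[x,x⁻¹]` determined by its values on the monomials
`x^n`, `n : ℤ`. -/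
noncomputable def onMonomials (g : ℤ → LaurentC) : LaurentC →ₗ[ℂ] LaurentC :=
  Finsupp.lsum ℂ fun n => LinearMap.toSpanSingleton ℂ LaurentC (g n)

/-- Multiplication by `x`. -/
noncomputable def mulX : LaurentC →ₗ[ℂ] LaurentC :=
  onMonomials fun n => Finsupp.single (n + 1) 1

/-- The operator `s_i : x^n ↦ λ^{i n} x^n`. -/
noncomputable def sOp (lam : ℂ) (i : ℕ) : LaurentC →ₗ[ℂ] LaurentC :=
  onMonomials fun n => Finsupp.single n (lam ^ ((i : ℤ) * n))

/-- The Dunkl operator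
`D(x^n) = n x^{n-1} + p·x^n + Σ_{i=1}^{m-1} (2 c_i (1-λ^{in})/(1-λ^i)) x^{n-1}`. -/
noncomputable def dunkl (m : ℕ) (lam : ℂ) (c : ℕ → ℂ) (p : LaurentC) : LaurentC →ₗ[ℂ] LaurentC :=
  onMonomials fun n =>
    Finsupp.mapDomain (· + n) p +
      ((n : ℂ) + ∑ i ∈ Finset.Icc 1 (m - 1),
          2 * c i * (1 - lam ^ ((i : ℤ) * n)) / (1 - lam ^ (i : ℤ))) • Finsupp.single (n - 1) 1

/-- A subspace `N ⊆ ℂ[x,x⁻¹]` is an invariant subspace if it is closed under multiplication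
by `x`, under `s_1`, and under the Dunkl operator `D`; invariant subspaces are exactly the
submodules of the rational Cherednik algebra module `j₀M`. -/
def IsInvariantSubspace (m : ℕ) (lam : ℂ) (c : ℕ → ℂ) (p : LaurentC) (N : Submodule ℂ LaurentC) : Prop :=
  (∀ f ∈ N, mulX f ∈ N) ∧ (∀ f ∈ N, sOp lam 1 f ∈ N) ∧ (∀ f ∈ N, dunkl m lam c p f ∈ N)

/-- The subspace `x^k ℂ[x]`: the span of the monomials `x^n` with `n ≥ k`. -/
noncomputable def tailSpace (k : ℤ) : Submodule ℂ LaurentC :=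
  Submodule.span ℂ {f : LaurentC | ∃ n : ℤ, k ≤ n ∧ f = Finsupp.single n 1}

def shiftL (k : ℤ) : LaurentC →ₗ[ℂ] LaurentC := Finsupp.lmapDomain ℂ ℂ (· + k)

lemma shiftL_single (k n : ℤ) (a : ℂ) :
    shiftL k (Finsupp.single n a) = Finsupp.single (n + k) a := by
  simp [shiftL, Finsupp.lmapDomain_apply, Finsupp.mapDomain_single]

lemma onMonomials_single (g : ℤ → LaurentC) (n : ℤ) (a : ℂ) :
    onMonomials g (Finsupp.single n a) = a • g n := by
  simp [onMonomials]

lemma shiftL_apply (k n : ℤ) (f : LaurentC) : shiftL k f (n + k) = f n := by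
  unfold shiftL
  rw [Finsupp.lmapDomain_apply]
  exact Finsupp.mapDomain_apply (add_left_injective k) f n

lemma shiftL_comp (j k : ℤ) (f : LaurentC) : shiftL j (shiftL k f) = shiftL (k + j) f := by
  ext n
  have h1 := shiftL_apply j (n - j) (shiftL k f)
  have h2 := shiftL_apply k (n - j - k) f
  have h3 := shiftL_apply (k + j) (n - j - k) f
  simp only [sub_add_cancel] at h1 h2
  rw [show n - j - k + (k + j) = n by ring] at h3
  rw [h1, h2, h3]

def diagL (g : ℤ → ℂ) : LaurentC →ₗ[ℂ] LaurentC := onMonomials fun n => Finsupp.single n (g n)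

lemma diagL_apply (g : ℤ → ℂ) (f : LaurentC) (n : ℤ) : diagL g f n = g n * f n := by
  induction f using Finsupp.induction_linear with
  | zero => simp
  | add f1 f2 h1 h2 => simp [h1, h2, mul_add]
  | single a b =>
    rw [diagL, onMonomials_single]
    by_cases h : a = n
    · subst h; simp [mul_comm]
    · simp [Finsupp.single_apply, h]

lemma mulX_eq (f : LaurentC) : mulX f = shiftL 1 f := by
  induction f using Finsupp.induction_linear with
  | zero => simp
  | add f1 f2 h1 h2 => simp [h1, h2]
  | single a b => rw [mulX, onMonomials_single, shiftL_single]; simp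

lemma dunkl_eq (m : ℕ) (lam : ℂ) (c : ℕ → ℂ) (p f : LaurentC) :
    dunkl m lam c p f = (∑ a ∈ p.support, p a • shiftL a f) +
      shiftL (-1) (diagL (fun n => (n : ℂ) + ∑ i ∈ Finset.Icc 1 (m - 1),
          2 * c i * (1 - lam ^ ((i : ℤ) * n)) / (1 - lam ^ (i : ℤ))) f) := by
  induction f using Finsupp.induction_linear with
  | zero => simp
  | add f1 f2 h1 h2 =>
    simp only [map_add, h1, h2, smul_add, Finset.sum_add_distrib]; abel
  | single n b =>
    rw [dunkl, onMonomials_single, diagL, onMonomials_single, map_smul, shiftL_single, smul_add]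
    congr 1
    · rw [Finsupp.mapDomain, Finsupp.sum, Finset.smul_sum]
      refine Finset.sum_congr rfl fun a _ => ?_
      rw [shiftL_single, add_comm n a]
      simp [mul_comm]
    · simp [sub_eq_add_neg]

lemma shiftL_mem {N : Submodule ℂ LaurentC} (hX : ∀ f ∈ N, mulX f ∈ N) {f : LaurentC}
    (hf : f ∈ N) (k : ℤ) (hk : 0 ≤ k) : shiftL k f ∈ N := by
  obtain ⟨k, rfl⟩ := Int.eq_ofNat_of_zero_le hk
  clear hk
  induction k with
  | zero =>
    have : shiftL ((0 : ℕ) : ℤ) f = f := by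
      ext n
      simpa using shiftL_apply 0 n f
    rwa [this]
  | succ k ih =>
    have := hX _ ih
    rw [mulX_eq, shiftL_comp] at this
    exact_mod_cast this

lemma key {N : Submodule ℂ LaurentC} {f : LaurentC}
    (hmin : ∀ g ∈ N, g ≠ 0 → f.support.card ≤ g.support.card) (g : ℤ → ℂ) (k n0 : ℤ)
    (hn0 : f n0 ≠ 0) (hg : g n0 = 0) (h : shiftL k (diagL g f) ∈ N) (n : ℤ) (hn : f n ≠ 0) :
    g n = 0 := by
  by_contra hgn
  have hne : shiftL k (diagL g f) ≠ 0 := by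
    intro h0
    have := shiftL_apply k n (diagL g f)
    rw [h0, diagL_apply] at this
    simp [hgn, hn] at this
  have h1 := hmin _ h hne
  have h2 : (shiftL k (diagL g f)).support.card ≤ (diagL g f).support.card := by
    have : (shiftL k (diagL g f)).support ⊆ (diagL g f).support.image (· + k) :=
      Finsupp.mapDomain_support
    exact (Finset.card_le_card this).trans Finset.card_image_le
  have h3 : (diagL g f).support.card < f.support.card := by
    apply Finset.card_lt_card
    rw [Finset.ssubset_iff_of_subset]
    · exact ⟨n0, by simpa using hn0, by simp [diagL_apply, hg]⟩
    · intro a ha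
      rw [Finsupp.mem_support_iff, diagL_apply] at ha
      simpa using right_ne_zero_of_mul ha
  omega

lemma exists_single (m : ℕ) (lam : ℂ) (c : ℕ → ℂ) (p : LaurentC)
    (N : Submodule ℂ LaurentC) (hN : IsInvariantSubspace m lam c p N) (hbot : N ≠ ⊥) :
    ∃ n : ℤ, Finsupp.single n (1 : ℂ) ∈ N := by
  obtain ⟨hX, hS, hD⟩ := hN
  obtain ⟨f0, hf0, hf0'⟩ := N.exists_mem_ne_zero_of_ne_bot hbot
  obtain ⟨f, hf, hfne, hmin⟩ : ∃ f ∈ N, f ≠ 0 ∧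
      ∀ g ∈ N, g ≠ 0 → f.support.card ≤ g.support.card := by
    have hne : {f : LaurentC | f ∈ N ∧ f ≠ 0}.Nonempty := ⟨f0, hf0, hf0'⟩
    refine ⟨Function.argminOn (fun f : LaurentC => f.support.card) _ hne,
      (Function.argminOn_mem _ _ hne).1, (Function.argminOn_mem _ _ hne).2, fun g hg hg' => ?_⟩
    exact Function.argminOn_le (fun f : LaurentC => f.support.card)
      {f : LaurentC | f ∈ N ∧ f ≠ 0} (a := g) (show g ∈ N ∧ g ≠ 0 from ⟨hg, hg'⟩)
  obtain ⟨n0, hn0⟩ : ∃ n0, f n0 ≠ 0 := by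
    by_contra! h
    exact hfne (Finsupp.ext h)
  have h1 : ∀ n, f n ≠ 0 → lam ^ n - lam ^ n0 = 0 := by
    apply key hmin (fun n => lam ^ n - lam ^ n0) 0 n0 hn0 (by simp)
    apply shiftL_mem hX _ _ le_rfl
    have : diagL (fun n => lam ^ n - lam ^ n0) f = sOp lam 1 f - lam ^ n0 • f := by
      have hs : sOp lam 1 = diagL (fun n => lam ^ (((1 : ℕ) : ℤ) * n)) := rfl
      ext n
      simp [hs, diagL_apply, sub_mul]
    rw [this]
    exact N.sub_mem (hS f hf) (N.smul_mem _ hf)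
  obtain ⟨M, hM1, hM⟩ : ∃ M : ℤ, 1 ≤ M ∧ ∀ a ∈ p.support, 0 ≤ a + M := by
    obtain ⟨b, hb⟩ := p.support.bddBelow
    refine ⟨max 1 (-b), le_max_left _ _, fun a ha => ?_⟩
    have := hb (Finset.mem_coe.2 ha)
    have := le_max_right 1 (-b)
    omega
  set d : ℤ → ℂ := fun n => (n : ℂ) + ∑ i ∈ Finset.Icc 1 (m - 1),
          2 * c i * (1 - lam ^ ((i : ℤ) * n)) / (1 - lam ^ (i : ℤ)) with hd
  have h2 : ∀ n, f n ≠ 0 → d n - d n0 = 0 := by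
    apply key hmin (fun n => d n - d n0) (M - 1) n0 hn0 (by simp)
    have e1 : diagL (fun n => d n - d n0) f = diagL d f - d n0 • f := by
      ext n
      simp [diagL_apply, sub_mul]
    have e2 : shiftL (M - 1) (diagL (fun n => d n - d n0) f) =
        shiftL M (dunkl m lam c p f) - (∑ a ∈ p.support, p a • shiftL (a + M) f)
          - d n0 • shiftL (M - 1) f := by
      rw [dunkl_eq, e1]
      simp only [map_add, map_sum, map_smul, map_sub, shiftL_comp]
      rw [show -1 + M = M - 1 by ring]
      abel
    rw [e2]
    refine N.sub_mem (N.sub_mem (shiftL_mem hX (hD f hf) _ (by omega)) ?_) ?_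
    · exact N.sum_mem fun a ha => N.smul_mem _ (shiftL_mem hX hf _ (hM a ha))
    · exact N.smul_mem _ (shiftL_mem hX hf _ (by omega))
  have h3 : ∀ n, f n ≠ 0 → n = n0 := by
    intro n hn
    have a1 := sub_eq_zero.1 (h1 n hn)
    have a2 := sub_eq_zero.1 (h2 n hn)
    have a3 : ∀ i : ℕ, lam ^ ((i : ℤ) * n) = lam ^ ((i : ℤ) * n0) := by
      intro i
      rw [zpow_mul', zpow_mul', a1]
    simp only [hd, a3] at a2
    exact_mod_cast add_right_cancel a2
  refine ⟨n0, ?_⟩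
  have : Finsupp.single n0 (1 : ℂ) = (f n0)⁻¹ • f := by
    ext n
    by_cases h : n = n0
    · subst h; simp [hn0]
    · have : f n = 0 := by
        by_contra h'
        exact h (h3 n h')
      simp [this, h]
  rw [this]
  exact N.smul_mem _ hf

lemma mem_of_singles {N : Submodule ℂ LaurentC} {f : LaurentC}
    (h : ∀ n, f n ≠ 0 → Finsupp.single n (1 : ℂ) ∈ N) : f ∈ N := by
  rw [← Finsupp.sum_single f]
  refine N.sum_mem fun n hn => ?_
  have := N.smul_mem (f n) (h n (by simpa using hn))
  simpa using this

/-- Every proper invariant subspace `N` of `ℂ[x,x⁻¹]` is contained in some `x^{−K}ℂ[x]`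
(equivalently, it is finitely generated over the polynomial subring `ℂ[x]`). -/
theorem proper_invariant_subspace_coherent
    (m : ℕ) (hm : 2 ≤ m) (lam : ℂ) (hlam : IsPrimitiveRoot lam m)
    (c : ℕ → ℂ) (p : LaurentC) (hp : ∀ n : ℤ, ¬ ((m : ℤ) ∣ (n + 1)) → p n = 0)
    (N : Submodule ℂ LaurentC) (hN : IsInvariantSubspace m lam c p N) (hNtop : N ≠ ⊤) :
    ∃ K : ℤ, N ≤ tailSpace (-K) := by
  by_contra! hcon
  have hX := hN.1
  have hlow : ∀ k : ℤ, ∃ g ∈ N, ∃ j < k, g j ≠ 0 := by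
    intro k
    obtain ⟨g, hg, hg'⟩ := SetLike.not_le_iff_exists.1 (hcon (-k))
    refine ⟨g, hg, ?_⟩
    by_contra! h
    apply hg'
    refine mem_of_singles fun n hn => Submodule.subset_span ⟨n, ?_, rfl⟩
    by_contra h'
    exact hn (h n (by omega))
  have hbot : N ≠ ⊥ := by
    rintro rfl
    obtain ⟨g, hg, j, -, hj⟩ := hlow 0
    rw [Submodule.mem_bot] at hg
    simp [hg] at hj
  obtain ⟨n0, hn0⟩ := exists_single m lam c p N hN hbot
  have hall : ∀ k : ℕ, ∀ n : ℤ, n0 - k ≤ n → Finsupp.single n (1 : ℂ) ∈ N := by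
    intro k
    induction k with
    | zero =>
      intro n hn
      have := shiftL_mem hX hn0 (n - n0) (by simpa using hn)
      rwa [shiftL_single, add_sub_cancel] at this
    | succ k ih =>
      intro n hn
      rcases le_or_gt (n0 - k) n with h | h
      · exact ih n h
      obtain ⟨g, hg, j', hj'n, hj'⟩ := hlow n
      have hne : g.support.Nonempty := ⟨j', by simpa using hj'⟩
      set j := g.support.min' hne with hjdef
      have hj : g j ≠ 0 := by simpa using g.support.min'_mem hne
      have hjmin : ∀ i, g i ≠ 0 → j ≤ i := fun i hi =>
        g.support.min'_le i (by simpa using hi)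
      have hjn : j ≤ j' := hjmin j' hj'
      have hmem := shiftL_mem hX hg (n - j) (by omega)
      have hco : ∀ i, shiftL (n - j) g i = g (i - (n - j)) := by
        intro i
        have := shiftL_apply (n - j) (i - (n - j)) g
        rwa [sub_add_cancel] at this
      have hrest : shiftL (n - j) g - g j • Finsupp.single n (1 : ℂ) ∈ N := by
        refine mem_of_singles fun i hi => ?_
        rw [Finsupp.sub_apply, Finsupp.smul_apply, hco] at hi
        by_cases hin : i = n
        · subst hin
          simp at hi
        · have : g (i - (n - j)) ≠ 0 := by
            simpa [Finsupp.single_apply, Ne.symm hin] using hi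
          have := hjmin _ this
          apply ih
          push_cast at hn
          omega
      have h5 := N.smul_mem (g j)⁻¹ (N.sub_mem hmem hrest)
      rw [sub_sub_cancel, smul_smul, inv_mul_cancel₀ hj, one_smul] at h5
      exact h5
  apply hNtop
  rw [eq_top_iff]
  intro f _
  exact mem_of_singles fun n _ => hall (n0 - n).toNat n (by omega)
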